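/- arXiv:1109.3929 — 2 statements merged into one kernel-verified Lean document; each statement's English description precedes it below -/
import Mathlib

section
/- For any integer n ≥ 2, the total bondage number of the grid graph G_{n,2} = P_n □ P_2 is: b_t(G_{n,2}) = 1 if n ≡ 0 (mod 3), b_t(G_{n,2}) = 2 if n ≡ 2 (mod 3), and b_t(G_{n,2}) = 3 if n ≡ 1 (mod 3). -/
open SimpleGraph

/-- The grid graph `G_{n,m}`, the Cartesian (box) product of paths `P_n` and `P_m`. -/
def gridGraph (n m : ℕ) : SimpleGraph (Fin n × Fin m) :=
  (pathGraph n) □ (pathGraph m)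

/-- `D` is a total dominating set of `G`: every vertex has a neighbor in `D`. -/
def IsTotalDomSet {V : Type*} (G : SimpleGraph V) (D : Set V) : Prop :=
  ∀ v : V, ∃ u ∈ D, G.Adj v u

/-- The total domination number of `G`. -/
noncomputable def totalDomNum {V : Type*} [Fintype V] (G : SimpleGraph V) : ℕ :=
  sInf {k | ∃ D : Finset V, IsTotalDomSet G ↑D ∧ D.card = k}

/-- The total bondage number: the least number of edges whose removal increases
the total domination number. -/
noncomputable def totalBondage {V : Type*} [Fintype V] (G : SimpleGraph V) : ℕ :=
  sInf {k | ∃ F : Finset (Sym2 V), ↑F ⊆ G.edgeSet ∧ F.card = k ∧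
    totalDomNum (G.deleteEdges ↑F) > totalDomNum G}

section TotalDomination

variable {V : Type*} [Fintype V] {G : SimpleGraph V}

theorem totalDomNum_le {D : Finset V} (hD : IsTotalDomSet G ↑D) : totalDomNum G ≤ D.card :=
  Nat.sInf_le ⟨D, hD, rfl⟩

theorem exists_adj_of_totalDomNum_pos (h : 0 < totalDomNum G) (v : V) : ∃ u, G.Adj v u := by
  obtain ⟨_, D, hD, _⟩ := Nat.nonempty_of_pos_sInf h
  obtain ⟨u, _, hu⟩ := hD v
  exact ⟨u, hu⟩

/-- A family of vertices without common neighbors bounds the total domination number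
from below. -/
theorem card_le_totalDomNum {ι : Type*} [Fintype ι] (hG : ∀ v, ∃ u, G.Adj v u) (p : ι → V)
    (hp : ∀ i j u, G.Adj (p i) u → G.Adj (p j) u → i = j) :
    Fintype.card ι ≤ totalDomNum G := by
  refine le_csInf ⟨_, Finset.univ, fun v => ?_, rfl⟩ ?_
  · obtain ⟨u, hu⟩ := hG v
    exact ⟨u, by simp, hu⟩
  · rintro _ ⟨D, hD, rfl⟩
    choose f hfD hf using fun i => hD (p i)
    refine Finset.card_le_card_of_injOn f (fun i _ => hfD i) fun i _ j _ hij => ?_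
    exact hp i j (f i) (hf i) (hij ▸ hf j)

end TotalDomination

section Ladder

variable {n : ℕ}

/-- The color of a vertex of the ladder in its proper 2-coloring. -/
def gridColor (v : Fin n × Fin 2) : ℕ := (v.1.val + v.2.val) % 2

/-- The vertex of the ladder in column `i` with color `c`. -/
def gridVertex (c i : ℕ) (hi : i < n) : Fin n × Fin 2 :=
  (⟨i, hi⟩, ⟨(i + c) % 2, Nat.mod_lt _ two_pos⟩)

@[simp] theorem gridVertex_fst (c i : ℕ) (hi : i < n) : (gridVertex c i hi).1.val = i := rfl

theorem gridColor_gridVertex {c : ℕ} (hc : c < 2) (i : ℕ) (hi : i < n) :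
    gridColor (gridVertex c i hi) = c := by
  simp only [gridColor, gridVertex]
  omega

theorem gridColor_lt (v : Fin n × Fin 2) : gridColor v < 2 := Nat.mod_lt _ two_pos

theorem eq_of_gridColor_eq {u v : Fin n × Fin 2} (hc : gridColor u = gridColor v)
    (h : u.1.val = v.1.val) : u = v := by
  have hu := u.2.isLt
  have hv := v.2.isLt
  simp only [gridColor] at hc
  exact Prod.ext (Fin.ext h) (Fin.ext (by omega))

theorem gridGraph_two_adj {u v : Fin n × Fin 2} :
    (gridGraph n 2).Adj u v ↔
      gridColor u ≠ gridColor v ∧ u.1.val ≤ v.1.val + 1 ∧ v.1.val ≤ u.1.val + 1 := by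
  have hu := u.2.isLt
  have hv := v.2.isLt
  simp only [gridGraph, boxProd_adj, pathGraph_adj, gridColor, Fin.ext_iff]
  omega

theorem gridGraph_two_deleteEdges_adj {F : Finset (Sym2 (Fin n × Fin 2))}
    {u v : Fin n × Fin 2} :
    ((gridGraph n 2).deleteEdges ↑F).Adj u v ↔
      (gridColor u ≠ gridColor v ∧ u.1.val ≤ v.1.val + 1 ∧ v.1.val ≤ u.1.val + 1) ∧
        s(u, v) ∉ F := by
  simp [deleteEdges_adj, gridGraph_two_adj]

/-- If `F` has fewer edges than there are residues in `T`, then some residue in `T` is not the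
residue mod 3 of the column of any endpoint with color `c` of an edge in `F`. -/
theorem exists_residue_avoiding {F : Finset (Sym2 (Fin n × Fin 2))}
    (hF : ↑F ⊆ (gridGraph n 2).edgeSet) (c : ℕ) (T : Finset ℕ) (hT : F.card < T.card) :
    ∃ r ∈ T, ∀ u v : Fin n × Fin 2, gridColor u = c → u.1.val % 3 = r → s(v, u) ∉ F := by
  by_contra! h
  obtain ⟨r₀, hr₀⟩ := Finset.card_pos.1 (Nat.zero_lt_of_lt hT)
  have : Nonempty (Fin n × Fin 2) := ⟨(h r₀ hr₀).choose⟩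
  choose! u v hc hr hm using h
  refine hT.not_ge (Finset.card_le_card_of_injOn (fun r => s(v r, u r))
    (fun r hr => hm r hr) fun r hrT s hsT hrs => ?_)
  have h1 := hF (hm r hrT)
  have h2 := hc r hrT
  have h3 := hc s hsT
  rcases Sym2.eq_iff.1 hrs with ⟨-, h⟩ | ⟨h, h'⟩
  · rw [← hr r hrT, ← hr s hsT, h]
  · rw [h, mem_edgeSet, gridGraph_two_adj] at h1
    omega

/-- Removing fewer edges than the claimed total bondage number, without isolating a vertex, leaves
each color class dominated by `⌈n / 3⌉` vertices. -/
theorem exists_dominating_color {F : Finset (Sym2 (Fin n × Fin 2))}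
    (hF : ↑F ⊆ (gridGraph n 2).edgeSet)
    (hcard : F.card < if n % 3 = 0 then 1 else if n % 3 = 2 then 2 else 3)
    (hG : ∀ v, ∃ u, ((gridGraph n 2).deleteEdges ↑F).Adj v u) {c : ℕ} (hc : c < 2) :
    ∃ D : Finset (Fin n × Fin 2), D.card ≤ (n + 2) / 3 ∧
      ∀ v, gridColor v = c → ∃ u ∈ D, ((gridGraph n 2).deleteEdges ↑F).Adj v u := by
  classical
  let R (r : ℕ) : Finset (Fin n × Fin 2) :=
    Finset.univ.filter fun u => gridColor u = 1 - c ∧ u.1.val % 3 = r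
  have hR (r : ℕ) : (R r).card ≤ (n + 2 - r) / 3 := by
    rw [← Finset.card_range ((n + 2 - r) / 3)]
    refine Finset.card_le_card_of_injOn (fun u => u.1.val / 3) (fun u hu => ?_)
      fun u hu v hv huv => ?_
    · have := u.1.isLt
      simp only [R, Finset.coe_filter, Finset.mem_univ, true_and, Set.mem_ofPred_eq] at hu
      simp only [Finset.coe_range, Set.mem_Iio]
      omega
    · simp only [R, Finset.coe_filter, Finset.mem_univ, true_and, Set.mem_ofPred_eq] at hu hv
      exact eq_of_gridColor_eq (hu.1.trans hv.1.symm) (by dsimp only at huv; omega)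
  have key (r : ℕ)
      (hr : ∀ u v : Fin n × Fin 2, gridColor u = 1 - c → u.1.val % 3 = r → s(v, u) ∉ F)
      (v : Fin n × Fin 2) (hv : gridColor v = c) (i : ℕ) (hi : i < n) (hir : i % 3 = r)
      (h1 : v.1.val ≤ i + 1) (h2 : i ≤ v.1.val + 1) :
      ∃ u ∈ R r, ((gridGraph n 2).deleteEdges ↑F).Adj v u := by
    have hcol := gridColor_gridVertex (show 1 - c < 2 by omega) i hi
    refine ⟨gridVertex (1 - c) i hi, by simp [R, hcol, hir],
      gridGraph_two_deleteEdges_adj.2 ⟨⟨by omega, h1, h2⟩, hr _ _ hcol hir⟩⟩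
  have hn (v : Fin n × Fin 2) := v.1.isLt
  have hres : ∃ r, (r = 1 ∨ n % 3 = 1 ∧ r = 2 ∨ n % 3 ≠ 0 ∧ r = 0) ∧
      ∀ u v : Fin n × Fin 2, gridColor u = 1 - c → u.1.val % 3 = r → s(v, u) ∉ F := by
    have ⟨T, hT, hmem⟩ : ∃ T : Finset ℕ, F.card < T.card ∧
        ∀ r ∈ T, r = 1 ∨ n % 3 = 1 ∧ r = 2 ∨ n % 3 ≠ 0 ∧ r = 0 := by
      split_ifs at hcard with h0 h2
      · exact ⟨{1}, by simpa using hcard, by simp⟩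
      · exact ⟨{0, 1}, by simpa using hcard, by simp; omega⟩
      · exact ⟨{0, 1, 2}, by simpa using hcard, by simp; omega⟩
    obtain ⟨r, hrT, hr⟩ := exists_residue_avoiding hF (1 - c) T hT
    exact ⟨r, hmem r hrT, hr⟩
  obtain ⟨r, hrn, hr⟩ := hres
  by_cases hall : ∀ v, gridColor v = c → ∃ u ∈ R r, ((gridGraph n 2).deleteEdges ↑F).Adj v u
  · exact ⟨R r, (hR r).trans (Nat.div_le_div_right (by omega)), hall⟩
  push Not at hall
  obtain ⟨w, hw, hwn⟩ := hall
  have hstep (v : Fin n × Fin 2) (hv : gridColor v = c) :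
      (∃ u ∈ R r, ((gridGraph n 2).deleteEdges ↑F).Adj v u) ∨
        n % 3 = 1 ∧ (r = 1 ∧ v.1.val = n - 1 ∨ r = 2 ∧ v.1.val = 0) := by
    by_contra! hcon
    obtain ⟨hno, hcon⟩ := hcon
    have hvn := hn v
    have hmem (i : ℕ) (hi : i < n) (h : i % 3 = r) (h1 : v.1.val ≤ i + 1)
        (h2 : i ≤ v.1.val + 1) : False := by
      obtain ⟨u, hu, ha⟩ := key r hr v hv i hi h h1 h2
      exact hno u hu ha
    by_cases ha : v.1.val % 3 = r
    · exact hmem _ hvn ha (by omega) (by omega)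
    by_cases hb : v.1.val + 1 < n ∧ (v.1.val + 1) % 3 = r
    · exact hmem _ hb.1 hb.2 (by omega) (by omega)
    exact hmem (v.1.val - 1) (by omega) (by omega) (by omega) (by omega)
  have hwcol : n % 3 = 1 ∧ (r = 1 ∧ w.1.val = n - 1 ∨ r = 2 ∧ w.1.val = 0) := by
    rcases hstep w hw with ⟨u, hu, ha⟩ | h
    · exact absurd ha (hwn u hu)
    · exact h
  obtain ⟨x, hx⟩ := hG w
  refine ⟨insert x (R r), (Finset.card_insert_le _ _).trans ?_, fun v hv => ?_⟩
  · have := hR r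
    omega
  · rcases hstep v hv with ⟨u, hu, ha⟩ | h
    · exact ⟨u, Finset.mem_insert_of_mem hu, ha⟩
    · obtain rfl : v = w := eq_of_gridColor_eq (hv.trans hw.symm) (by omega)
      exact ⟨x, Finset.mem_insert_self _ _, hx⟩

theorem totalDomNum_deleteEdges_le {F : Finset (Sym2 (Fin n × Fin 2))}
    (hF : ↑F ⊆ (gridGraph n 2).edgeSet)
    (hcard : F.card < if n % 3 = 0 then 1 else if n % 3 = 2 then 2 else 3) :
    totalDomNum ((gridGraph n 2).deleteEdges ↑F) ≤ 2 * ((n + 2) / 3) := by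
  classical
  rcases Nat.eq_zero_or_pos (totalDomNum ((gridGraph n 2).deleteEdges ↑F)) with h | h
  · omega
  have hG := exists_adj_of_totalDomNum_pos h
  obtain ⟨D₀, h₀, hD₀⟩ := exists_dominating_color hF hcard hG (c := 0) (by omega)
  obtain ⟨D₁, h₁, hD₁⟩ := exists_dominating_color hF hcard hG (c := 1) (by omega)
  refine (totalDomNum_le (D := D₀ ∪ D₁) fun v => ?_).trans
    ((Finset.card_union_le _ _).trans (by omega))
  have := gridColor_lt v
  obtain hv | hv : gridColor v = 0 ∨ gridColor v = 1 := by omega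
  · obtain ⟨u, hu, ha⟩ := hD₀ v hv
    exact ⟨u, by simp [hu], ha⟩
  · obtain ⟨u, hu, ha⟩ := hD₁ v hv
    exact ⟨u, by simp [hu], ha⟩

theorem totalDomNum_gridGraph_two_le : totalDomNum (gridGraph n 2) ≤ 2 * ((n + 2) / 3) := by
  have h := totalDomNum_deleteEdges_le (n := n) (F := ∅) (by simp) (by split_ifs <;> simp)
  simpa using h

theorem exists_adj_of_off_diagonal {F : Finset (Sym2 (Fin n × Fin 2))}
    (hF : ∀ u v, s(u, v) ∈ F → u.1 ≠ v.1) (v : Fin n × Fin 2) :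
    ∃ u, ((gridGraph n 2).deleteEdges ↑F).Adj v u := by
  have hv := gridColor_lt v
  have hc := gridColor_gridVertex (show 1 - gridColor v < 2 by omega) v.1.val v.1.isLt
  refine ⟨gridVertex (1 - gridColor v) v.1.val v.1.isLt,
    gridGraph_two_deleteEdges_adj.2 ⟨⟨by omega, ?_, ?_⟩, fun h => hF _ _ h rfl⟩⟩ <;> simp

theorem le_totalDomNum_gridGraph_two : 2 * ((n + 2) / 3) ≤ totalDomNum (gridGraph n 2) := by
  have h := card_le_totalDomNum (G := gridGraph n 2) (ι := Fin ((n + 2) / 3) × Fin 2)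
    (fun v => by simpa using exists_adj_of_off_diagonal (F := ∅) (by simp) v)
    (fun i => gridVertex i.2.val (3 * i.1.val) (by omega)) (fun i j u hi hj => by
      rw [gridGraph_two_adj, gridColor_gridVertex i.2.isLt, gridVertex_fst] at hi
      rw [gridGraph_two_adj, gridColor_gridVertex j.2.isLt, gridVertex_fst] at hj
      have := gridColor_lt u
      exact Prod.ext (Fin.ext (by omega)) (Fin.ext (by omega)))
  simp only [Fintype.card_prod, Fintype.card_fin] at h
  omega

/-- If the vertices of color 0 in the columns `a` and `f i` for `i < ⌈n / 3⌉` have no common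
neighbors after removing `F`, then removing `F` increases the total domination number. -/
theorem totalDomNum_lt_deleteEdges {F : Finset (Sym2 (Fin n × Fin 2))}
    (hF : ∀ u v, s(u, v) ∈ F → u.1 ≠ v.1)
    (a : ℕ) (ha : a < n) (f : ℕ → ℕ) (hf : ∀ i < (n + 2) / 3, f i < n)
    (haf : ∀ i (hi : i < (n + 2) / 3) u,
      ((gridGraph n 2).deleteEdges ↑F).Adj (gridVertex 0 a ha) u →
      ((gridGraph n 2).deleteEdges ↑F).Adj (gridVertex 0 (f i) (hf i hi)) u → False)
    (hff : ∀ i (hi : i < (n + 2) / 3) j (hj : j < (n + 2) / 3) u,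
      ((gridGraph n 2).deleteEdges ↑F).Adj (gridVertex 0 (f i) (hf i hi)) u →
      ((gridGraph n 2).deleteEdges ↑F).Adj (gridVertex 0 (f j) (hf j hj)) u → i = j) :
    totalDomNum (gridGraph n 2) < totalDomNum ((gridGraph n 2).deleteEdges ↑F) := by
  let p : Option (Fin ((n + 2) / 3)) ⊕ Fin ((n + 2) / 3) → Fin n × Fin 2
    | .inl none => gridVertex 0 a ha
    | .inl (some i) => gridVertex 0 (f i) (hf i i.isLt)
    | .inr i => gridVertex 1 (3 * i.val) (by omega)
  have hcol (x : Option (Fin ((n + 2) / 3))) : gridColor (p (.inl x)) = 0 := by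
    cases x <;> exact gridColor_gridVertex two_pos _ _
  have hcol' (x : Fin ((n + 2) / 3)) : gridColor (p (.inr x)) = 1 :=
    gridColor_gridVertex one_lt_two _ _
  have h := card_le_totalDomNum (exists_adj_of_off_diagonal hF) p (fun x y u hx hy => by
    have hu := gridColor_lt u
    have hx' := (gridGraph_two_deleteEdges_adj.1 hx).1
    have hy' := (gridGraph_two_deleteEdges_adj.1 hy).1
    rcases x with (_ | i) | i <;> rcases y with (_ | j) | j
    · rfl
    · exact (haf j j.isLt u hx hy).elim
    · have := hcol none
      have := hcol' j
      omega
    · exact (haf i i.isLt u hy hx).elim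
    · rw [Fin.ext (hff i i.isLt j j.isLt u hx hy)]
    · have := hcol (some i)
      have := hcol' j
      omega
    · have := hcol' i
      have := hcol none
      omega
    · have := hcol' i
      have := hcol (some j)
      omega
    · have h1 : (p (.inr i)).1.val = 3 * i.val := rfl
      have h2 : (p (.inr j)).1.val = 3 * j.val := rfl
      rw [show i = j from Fin.ext (by omega)])
  have hle := totalDomNum_gridGraph_two_le (n := n)
  simp only [Fintype.card_sum, Fintype.card_option, Fintype.card_fin] at h
  omega

/-- The edge joining the vertex of color 0 in column `i` to the vertex of color 1 in column `j`. -/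
def gridEdge (i j : ℕ) (hi : i < n) (hj : j < n) : Sym2 (Fin n × Fin 2) :=
  s(gridVertex 0 i hi, gridVertex 1 j hj)

theorem gridEdge_mem_edgeSet {i j : ℕ} (hi : i < n) (hj : j < n) (h1 : i ≤ j + 1)
    (h2 : j ≤ i + 1) : gridEdge i j hi hj ∈ (gridGraph n 2).edgeSet := by
  rw [gridEdge, mem_edgeSet, gridGraph_two_adj, gridColor_gridVertex two_pos,
    gridColor_gridVertex one_lt_two]
  exact ⟨zero_ne_one, h1, h2⟩

theorem fst_ne_of_eq_gridEdge {i j : ℕ} {hi : i < n} {hj : j < n} (hij : i ≠ j)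
    {u v : Fin n × Fin 2} (h : s(u, v) = gridEdge i j hi hj) : u.1 ≠ v.1 := by
  rcases Sym2.eq_iff.1 h with ⟨rfl, rfl⟩ | ⟨rfl, rfl⟩ <;> simp [gridVertex, hij, hij.symm]

/-- A vertex adjacent to the vertex of color 0 in column `i` after removing `F` lies in a column
at distance at most 1, other than those whose edge was removed. -/
theorem column_of_adj {F : Finset (Sym2 (Fin n × Fin 2))} {i : ℕ} {hi : i < n}
    {u : Fin n × Fin 2} (h : ((gridGraph n 2).deleteEdges ↑F).Adj (gridVertex 0 i hi) u) :
    (i ≤ u.1.val + 1 ∧ u.1.val ≤ i + 1) ∧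
      ∀ j (hj : j < n), gridEdge i j hi hj ∈ F → u.1.val ≠ j := by
  obtain ⟨⟨hc, h1, h2⟩, hm⟩ := gridGraph_two_deleteEdges_adj.1 h
  refine ⟨⟨h1, h2⟩, fun j hj hjF huj => hm ?_⟩
  rw [gridColor_gridVertex two_pos] at hc
  have := gridColor_lt u
  have hu : u = gridVertex 1 j hj :=
    eq_of_gridColor_eq (by rw [gridColor_gridVertex one_lt_two]; omega) huj
  rwa [hu]

theorem exists_increasing_edges (hn : 2 ≤ n) :
    ∃ F : Finset (Sym2 (Fin n × Fin 2)), ↑F ⊆ (gridGraph n 2).edgeSet ∧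
      F.card ≤ (if n % 3 = 0 then 1 else if n % 3 = 2 then 2 else 3) ∧
      totalDomNum (gridGraph n 2) < totalDomNum ((gridGraph n 2).deleteEdges ↑F) := by
  classical
  split_ifs with h0 h2
  · refine ⟨{gridEdge 0 1 (by omega) (by omega)}, ?_, by simp,
      totalDomNum_lt_deleteEdges ?_ 0 (by omega) (fun i => 3 * i + 2) (by omega) ?_ ?_⟩
    · simpa using gridEdge_mem_edgeSet _ _ (by omega) (by omega)
    · intro u v h
      exact fst_ne_of_eq_gridEdge (by omega) (Finset.mem_singleton.1 h)
    · intro i hi u h h'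
      have := (column_of_adj h).2 1 (by omega) (by simp)
      have := (column_of_adj h).1
      have := (column_of_adj h').1
      omega
    · intro i hi j hj u h h'
      have := (column_of_adj h).1
      have := (column_of_adj h').1
      omega
  · refine ⟨{gridEdge 0 1 (by omega) (by omega), gridEdge (n - 1) (n - 2) (by omega) (by omega)},
      ?_, Finset.card_le_two,
      totalDomNum_lt_deleteEdges ?_ 0 (by omega) (fun i => min (3 * i + 2) (n - 1)) (by omega)
        ?_ ?_⟩
    · simp only [Finset.coe_insert, Finset.coe_singleton, Set.insert_subset_iff,
        Set.singleton_subset_iff]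
      exact ⟨gridEdge_mem_edgeSet _ _ (by omega) (by omega),
        gridEdge_mem_edgeSet _ _ (by omega) (by omega)⟩
    · intro u v h
      simp only [Finset.mem_insert, Finset.mem_singleton] at h
      rcases h with h | h <;> exact fst_ne_of_eq_gridEdge (by omega) h
    · intro i hi u h h'
      have := (column_of_adj h).2 1 (by omega) (by simp)
      have := (column_of_adj h).1
      have := (column_of_adj h').1
      by_cases hlast : min (3 * i + 2) (n - 1) = n - 1
      · have := (column_of_adj h').2 (n - 2) (by omega) (by simp [hlast])
        omega
      · omega
    · intro i hi j hj u h h'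
      have := (column_of_adj h).1
      have := (column_of_adj h').1
      by_cases hi' : min (3 * i + 2) (n - 1) = n - 1
      · have := (column_of_adj h).2 (n - 2) (by omega) (by simp [hi'])
        omega
      by_cases hj' : min (3 * j + 2) (n - 1) = n - 1
      · have := (column_of_adj h').2 (n - 2) (by omega) (by simp [hj'])
        omega
      omega
  · refine ⟨{gridEdge 0 1 (by omega) (by omega), gridEdge 1 0 (by omega) (by omega),
      gridEdge 1 2 (by omega) (by omega)}, ?_, Finset.card_le_three,
      totalDomNum_lt_deleteEdges ?_ 1 (by omega) (fun i => 3 * i) (by omega) ?_ ?_⟩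
    · simp only [Finset.coe_insert, Finset.coe_singleton, Set.insert_subset_iff,
        Set.singleton_subset_iff]
      exact ⟨gridEdge_mem_edgeSet _ _ (by omega) (by omega),
        gridEdge_mem_edgeSet _ _ (by omega) (by omega),
        gridEdge_mem_edgeSet _ _ (by omega) (by omega)⟩
    · intro u v h
      simp only [Finset.mem_insert, Finset.mem_singleton] at h
      rcases h with h | h | h <;> exact fst_ne_of_eq_gridEdge (by omega) h
    · intro i hi u h h'
      have := (column_of_adj h).2 0 (by omega) (by simp)
      have := (column_of_adj h).2 2 (by omega) (by simp)
      have := (column_of_adj h).1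
      have := (column_of_adj h').1
      rcases Nat.eq_zero_or_pos i with rfl | hpos
      · have := (column_of_adj h').2 1 (by omega) (by simp)
        omega
      · omega
    · intro i hi j hj u h h'
      have := (column_of_adj h).1
      have := (column_of_adj h').1
      omega

end Ladder

theorem total_bondage_grid_two (n : ℕ) (hn : 2 ≤ n) :
    totalBondage (gridGraph n 2) =
      if n % 3 = 0 then 1 else if n % 3 = 2 then 2 else 3 := by
  obtain ⟨F, hF, hcard, hlt⟩ := exists_increasing_edges hn
  rw [totalBondage]
  refine le_antisymm (le_trans (Nat.sInf_le ⟨F, hF, rfl, hlt⟩) hcard) ?_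
  refine le_csInf ⟨_, F, hF, rfl, hlt⟩ ?_
  rintro _ ⟨F', hF', rfl, hlt'⟩
  by_contra! h
  have h1 := totalDomNum_deleteEdges_le hF' h
  have h2 := le_totalDomNum_gridGraph_two (n := n)
  omega
end

section
/- For n ≥ 4, the total domination number of G_{n,4} = P_n □ P_4 is γ_t(G_{n,4}) = ⌊(6n+8)/5⌋ if n ≡ 1, 2, 4 (mod 5), and γ_t(G_{n,4}) = ⌊(6n+8)/5⌋ + 1 otherwise. -/
open SimpleGraph

/-- Adjacency in `G_{n,m}` in terms of coordinates. -/
theorem gridGraph_adj {n m : ℕ} (u v : Fin n × Fin m) :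
    (gridGraph n m).Adj u v ↔
      ((u.1.val + 1 = v.1.val ∨ v.1.val + 1 = u.1.val) ∧ u.2 = v.2) ∨
        ((u.2.val + 1 = v.2.val ∨ v.2.val + 1 = u.2.val) ∧ u.1 = v.1) := by
  simp [gridGraph, boxProd_adj, pathGraph_adj]

/-- A lower bound for five times the weight of the columns seen so far, minus three per column,
as a function of the last two columns `(x, y)` and `(x', y')` of a half of a dominating set. -/
def halfPotential (x y x' y' : Bool) : ℤ :=
  (if x then (if y then 2 else 0) else (if y then -1 else -2)) +
    (if y' then (if x || y then 5 else 4) else 0) + (if x' then (if y then 5 else 3) else 0)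

theorem halfPotential_step : ∀ x y x' y' x'' y'' : Bool,
    (x' || y' || y || y'') = true → (y' || x || x'') = true →
      halfPotential x' y' x'' y'' + 3 ≤
        halfPotential x y x' y' + 5 * ((x''.toNat : ℤ) + y''.toNat) := by
  decide

theorem halfPotential_init : ∀ x₁ y₁ x₂ y₂ : Bool,
    (x₁ || y₁ || y₂) = true → (y₁ || x₂) = true → ∀ x₃ y₃ : Bool,
    (x₂ || y₂ || y₁ || y₃) = true → (y₂ || x₁ || x₃) = true → ∀ x₄ y₄ : Bool,
    (x₃ || y₃ || y₂ || y₄) = true → (y₃ || x₂ || x₄) = true →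
      halfPotential x₃ y₃ x₄ y₄ + 12 ≤
        5 * ((x₁.toNat : ℤ) + y₁.toNat + (x₂.toNat + y₂.toNat) + (x₃.toNat + y₃.toNat) +
          (x₄.toNat + y₄.toNat)) := by
  decide

theorem two_le_halfPotential : ∀ x y x' y' : Bool,
    (x' || y' || y) = true → (y' || x) = true → 2 ≤ halfPotential x y x' y' := by
  decide

/-- The grid `P_n □ P_4` is bipartite; after reflecting every other column, each half of a total
dominating set becomes a pair of 0-1 sequences satisfying two local constraints. -/
theorem half_weight_lower_bound {n : ℕ} (hn : 4 ≤ n) (x y : ℕ → Bool)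
    (hx₀ : x 0 = false) (hy₀ : y 0 = false)
    (hx : x (n + 1) = false) (hy : y (n + 1) = false)
    (h₁ : ∀ i < n, (x (i + 1) || y (i + 1) || y i || y (i + 2)) = true)
    (h₂ : ∀ i < n, (y (i + 1) || x i || x (i + 2)) = true) :
    3 * n + 2 ≤ 5 * ∑ i ∈ Finset.range n, ((x (i + 1)).toNat + (y (i + 1)).toNat) := by
  have key : ∀ k, 3 ≤ k → k < n →
      halfPotential (x k) (y k) (x (k + 1)) (y (k + 1)) + 3 * (k + 1) ≤
        5 * ∑ i ∈ Finset.range (k + 1), (((x (i + 1)).toNat : ℤ) + (y (i + 1)).toNat) := by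
    intro k hk
    induction k, hk using Nat.le_induction with
    | base =>
      intro _
      have a₀ := h₁ 0 (by omega)
      have b₀ := h₂ 0 (by omega)
      simp only [hx₀, hy₀, Bool.or_false, Nat.zero_add] at a₀ b₀
      have := halfPotential_init _ _ _ _ a₀ b₀ _ _ (h₁ 1 (by omega)) (h₂ 1 (by omega)) _ _
        (h₁ 2 (by omega)) (h₂ 2 (by omega))
      simp only [Finset.sum_range_succ, Finset.sum_range_zero]
      norm_num at this ⊢
      linarith
    | succ k _ ih =>
      intro hkn
      have := halfPotential_step _ _ _ _ _ _ (h₁ k (by omega)) (h₂ k (by omega))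
      rw [Finset.sum_range_succ]
      have := ih (by omega)
      push_cast at *
      linarith
  obtain ⟨k, rfl⟩ : ∃ k, n = k + 1 := ⟨n - 1, by omega⟩
  have a := h₁ k (by omega)
  have b := h₂ k (by omega)
  rw [hy, Bool.or_false] at a
  rw [hx, Bool.or_false] at b
  have := two_le_halfPotential _ _ _ _ a b
  have := key k (by omega) (by omega)
  zify
  push_cast at *
  linarith

/-- The indicator of a vertex set, with columns numbered from one. -/
noncomputable def columnIndicator {n : ℕ} (D : Finset (Fin n × Fin 4)) (i : ℕ) (j : Fin 4) :
    Bool :=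
  open Classical in decide (∃ p : Fin n, p.val + 1 = i ∧ (p, j) ∈ D)

theorem columnIndicator_eq_true {n : ℕ} {D : Finset (Fin n × Fin 4)} {i : ℕ} {j : Fin 4} :
    columnIndicator D i j = true ↔ ∃ p : Fin n, p.val + 1 = i ∧ (p, j) ∈ D := by
  simp [columnIndicator]

theorem columnIndicator_zero {n : ℕ} (D : Finset (Fin n × Fin 4)) (j : Fin 4) :
    columnIndicator D 0 j = false := by
  simp [columnIndicator]

theorem columnIndicator_last {n : ℕ} (D : Finset (Fin n × Fin 4)) (j : Fin 4) :
    columnIndicator D (n + 1) j = false := by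
  rw [← Bool.not_eq_true, columnIndicator_eq_true]
  rintro ⟨p, hp, -⟩
  omega

theorem card_eq_sum_columnIndicator {n : ℕ} (D : Finset (Fin n × Fin 4)) :
    D.card = ∑ i ∈ Finset.range n, ∑ j, (columnIndicator D (i + 1) j).toNat := by
  classical
  rw [← Fin.sum_univ_eq_sum_range (fun i => ∑ j, (columnIndicator D (i + 1) j).toNat),
    ← Fintype.sum_prod_type' (fun (i : Fin n) j => (columnIndicator D (i + 1) j).toNat),
    ← Finset.filter_univ_mem D, Finset.card_filter]
  refine Finset.sum_congr rfl fun p _ => ?_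
  have : columnIndicator D (p.1 + 1) p.2 = decide (p ∈ D) := by
    rw [Bool.eq_iff_iff, columnIndicator_eq_true, decide_eq_true_iff]
    constructor
    · rintro ⟨q, hq, hD⟩
      obtain rfl : q = p.1 := Fin.ext (by omega)
      exact hD
    · exact fun hD => ⟨p.1, rfl, hD⟩
  simp [this, Bool.toNat, Bool.cond_decide]

theorem IsTotalDomSet.exists_columnIndicator {n : ℕ} {D : Finset (Fin n × Fin 4)}
    (hD : IsTotalDomSet (gridGraph n 4) ↑D) {i : ℕ} (hi : i < n) (j : Fin 4) :
    columnIndicator D i j = true ∨ columnIndicator D (i + 2) j = true ∨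
      ∃ k : Fin 4, (j.val + 1 = k.val ∨ k.val + 1 = j.val) ∧
        columnIndicator D (i + 1) k = true := by
  obtain ⟨⟨p, k⟩, hpk, hadj⟩ := hD (⟨i, hi⟩, j)
  rw [Finset.mem_coe] at hpk
  rw [gridGraph_adj] at hadj
  simp only [columnIndicator_eq_true]
  rcases hadj with ⟨h | h, rfl⟩ | ⟨h, rfl⟩
  · exact Or.inr (Or.inl ⟨p, by simp at h; omega, hpk⟩)
  · exact Or.inl ⟨p, by simpa using h, hpk⟩
  · exact Or.inr (Or.inr ⟨k, h, _, rfl, hpk⟩)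

theorem IsTotalDomSet.card_lower_bound {n : ℕ} (hn : 4 ≤ n) {D : Finset (Fin n × Fin 4)}
    (hD : IsTotalDomSet (gridGraph n 4) ↑D) : 2 * ((3 * n + 6) / 5) ≤ D.card := by
  have half : ∀ p : ℕ, 3 * n + 2 ≤ 5 * ∑ i ∈ Finset.range n,
      ((columnIndicator D (i + 1) (if (i + 1 + p) % 2 = 0 then 0 else 3)).toNat +
        (columnIndicator D (i + 1) (if (i + 1 + p) % 2 = 0 then 2 else 1)).toNat) := by
    intro p
    refine half_weight_lower_bound hn
      (fun i => columnIndicator D i (if (i + p) % 2 = 0 then 0 else 3))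
      (fun i => columnIndicator D i (if (i + p) % 2 = 0 then 2 else 1))
      (columnIndicator_zero _ _) (columnIndicator_zero _ _)
      (columnIndicator_last _ _) (columnIndicator_last _ _) ?_ ?_
    all_goals
      intro i hi
      have r₀ := hD.exists_columnIndicator hi 0
      have r₁ := hD.exists_columnIndicator hi 1
      have r₂ := hD.exists_columnIndicator hi 2
      have r₃ := hD.exists_columnIndicator hi 3
      simp only [Fin.exists_fin_succ, Fin.exists_fin_zero] at r₀ r₁ r₂ r₃
      norm_num at r₀ r₁ r₂ r₃
      rcases Nat.mod_two_eq_zero_or_one (i + p) with h | h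
      · have h' : (i + 1 + p) % 2 = 1 := by omega
        have h'' : (i + 2 + p) % 2 = 0 := by omega
        simp only [h, h', h'', Bool.or_eq_true]
        norm_num
        grind only
      · have h' : (i + 1 + p) % 2 = 0 := by omega
        have h'' : (i + 2 + p) % 2 = 1 := by omega
        simp only [h, h', h'', Bool.or_eq_true]
        norm_num
        grind only
  have ceil_le : ∀ s : ℕ, 3 * n + 2 ≤ 5 * s → (3 * n + 6) / 5 ≤ s := by omega
  have h₀ := ceil_le _ (half 0)
  have h₁ := ceil_le _ (half 1)
  have hsum : D.card = ∑ i ∈ Finset.range n,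
      ((columnIndicator D (i + 1) (if (i + 1 + 0) % 2 = 0 then 0 else 3)).toNat +
        (columnIndicator D (i + 1) (if (i + 1 + 0) % 2 = 0 then 2 else 1)).toNat) +
      ∑ i ∈ Finset.range n,
      ((columnIndicator D (i + 1) (if (i + 1 + 1) % 2 = 0 then 0 else 3)).toNat +
        (columnIndicator D (i + 1) (if (i + 1 + 1) % 2 = 0 then 2 else 1)).toNat) := by
    rw [card_eq_sum_columnIndicator, ← Finset.sum_add_distrib]
    refine Finset.sum_congr rfl fun i _ => ?_
    rw [Fin.sum_univ_four]
    rcases Nat.mod_two_eq_zero_or_one i with h | h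
    · have h' : (i + 1 + 0) % 2 = 1 := by omega
      have h'' : (i + 1 + 1) % 2 = 0 := by omega
      simp only [h', h'']
      norm_num
      omega
    · have h' : (i + 1 + 0) % 2 = 0 := by omega
      have h'' : (i + 1 + 1) % 2 = 1 := by omega
      simp only [h', h'']
      norm_num
      omega
  omega

/-- Whether the optimal pattern contains the two outer vertices of column `i`. -/
def OuterPattern (n i : ℕ) : Prop :=
  if i + 1 = n then n % 5 = 0 ∨ n % 5 = 3 ∨ n % 5 = 4 else i % 5 = 2 ∨ i % 5 = 3

/-- Whether the optimal pattern contains the two inner vertices of column `i`. -/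
def InnerPattern (n i : ℕ) : Prop :=
  if i + 1 = n then n % 5 = 1 ∨ n % 5 = 2 ∨ n % 5 = 3 else i % 5 = 0

instance (n i : ℕ) : Decidable (OuterPattern n i) := by
  unfold OuterPattern; infer_instance

instance (n i : ℕ) : Decidable (InnerPattern n i) := by
  unfold InnerPattern; infer_instance

/-- The total dominating set of `P_n □ P_4` given by the pattern. -/
def patternSet (n : ℕ) : Finset (Fin n × Fin 4) :=
  {p | if p.2 = 0 ∨ p.2 = 3 then OuterPattern n p.1 else InnerPattern n p.1}

theorem pattern_dominates_inner {n i : ℕ} (hn : 4 ≤ n) (hi : i < n) :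
    OuterPattern n i ∨ InnerPattern n i ∨ (0 < i ∧ InnerPattern n (i - 1)) ∨
      (i + 1 < n ∧ InnerPattern n (i + 1)) := by
  unfold OuterPattern InnerPattern
  split_ifs <;> omega

theorem pattern_dominates_outer {n i : ℕ} (hn : 4 ≤ n) (hi : i < n) :
    InnerPattern n i ∨ (0 < i ∧ OuterPattern n (i - 1)) ∨
      (i + 1 < n ∧ OuterPattern n (i + 1)) := by
  unfold OuterPattern InnerPattern
  split_ifs <;> omega

theorem isTotalDomSet_patternSet {n : ℕ} (hn : 4 ≤ n) :
    IsTotalDomSet (gridGraph n 4) ↑(patternSet n) := by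
  rintro ⟨⟨i, hi⟩, j⟩
  have mem_outer : ∀ p : Fin n, ∀ k : Fin 4, k = 0 ∨ k = 3 → OuterPattern n p →
      (p, k) ∈ (↑(patternSet n) : Set (Fin n × Fin 4)) := by
    intro p k hk hp
    simp [patternSet, hk, hp]
  have mem_inner : ∀ p : Fin n, ∀ k : Fin 4, ¬ (k = 0 ∨ k = 3) → InnerPattern n p →
      (p, k) ∈ (↑(patternSet n) : Set (Fin n × Fin 4)) := by
    intro p k hk hp
    simp only [patternSet, Finset.coe_filter, Finset.mem_univ, true_and, Set.mem_ofPred_eq,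
      if_neg hk, hp]
  simp only [gridGraph_adj]
  by_cases hj : j = 0 ∨ j = 3
  · rcases pattern_dominates_outer hn hi with h | ⟨h0, h⟩ | ⟨h0, h⟩
    · rcases hj with rfl | rfl
      · exact ⟨(⟨i, hi⟩, 1), mem_inner _ _ (by decide) h, by simp⟩
      · exact ⟨(⟨i, hi⟩, 2), mem_inner _ _ (by decide) h, by simp⟩
    · exact ⟨(⟨i - 1, by omega⟩, j), mem_outer _ _ hj h, by simp; omega⟩
    · exact ⟨(⟨i + 1, h0⟩, j), mem_outer _ _ hj h, by simp⟩
  · rcases pattern_dominates_inner hn hi with h | h | ⟨h0, h⟩ | ⟨h0, h⟩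
    · obtain rfl | rfl : j = 1 ∨ j = 2 := by omega
      · exact ⟨(⟨i, hi⟩, 0), mem_outer _ _ (by decide) h, by simp⟩
      · exact ⟨(⟨i, hi⟩, 3), mem_outer _ _ (by decide) h, by simp⟩
    · obtain rfl | rfl : j = 1 ∨ j = 2 := by omega
      · exact ⟨(⟨i, hi⟩, 2), mem_inner _ _ (by decide) h, by simp⟩
      · exact ⟨(⟨i, hi⟩, 1), mem_inner _ _ (by decide) h, by simp⟩
    · exact ⟨(⟨i - 1, by omega⟩, j), mem_inner _ _ hj h, by simp; omega⟩
    · exact ⟨(⟨i + 1, h0⟩, j), mem_inner _ _ hj h, by simp⟩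

theorem card_patternSet {n : ℕ} (hn : 4 ≤ n) : (patternSet n).card = 2 * ((3 * n + 6) / 5) := by
  have hsum : (patternSet n).card = ∑ i ∈ Finset.range n,
      ((if OuterPattern n i then 2 else 0) + (if InnerPattern n i then 2 else 0)) := by
    rw [patternSet, Finset.card_filter, Fintype.sum_prod_type, ← Fin.sum_univ_eq_sum_range
      (fun i => (if OuterPattern n i then 2 else 0) + (if InnerPattern n i then 2 else 0))]
    refine Finset.sum_congr rfl fun i _ => ?_
    rw [Fin.sum_univ_four]
    by_cases ho : OuterPattern n i <;> by_cases hi : InnerPattern n i <;> simp [ho, hi]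
  have hprefix : ∀ m < n, ∑ i ∈ Finset.range m,
      ((if OuterPattern n i then 2 else 0) + (if InnerPattern n i then 2 else 0)) =
        2 * ((3 * m + 3) / 5) := by
    intro m
    induction m with
    | zero => simp
    | succ m ih =>
      intro hm
      rw [Finset.sum_range_succ, ih (by omega)]
      simp only [OuterPattern, InnerPattern, if_neg hm.ne]
      split_ifs <;> omega
  obtain ⟨m, rfl⟩ : ∃ m, n = m + 1 := ⟨n - 1, by omega⟩
  rw [hsum, Finset.sum_range_succ, hprefix m (by omega)]
  simp only [OuterPattern, InnerPattern, if_true]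
  split_ifs <;> omega

theorem total_domination_grid_four (n : ℕ) (hn : 4 ≤ n) :
    totalDomNum (gridGraph n 4) =
      if n % 5 = 1 ∨ n % 5 = 2 ∨ n % 5 = 4 then (6 * n + 8) / 5
      else (6 * n + 8) / 5 + 1 := by
  have hval : totalDomNum (gridGraph n 4) = 2 * ((3 * n + 6) / 5) := by
    refine le_antisymm (Nat.sInf_le ⟨_, isTotalDomSet_patternSet hn, card_patternSet hn⟩) ?_
    refine le_csInf ⟨_, _, isTotalDomSet_patternSet hn, rfl⟩ ?_
    rintro k ⟨D, hD, rfl⟩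
    exact hD.card_lower_bound hn
  rw [hval]
  split_ifs <;> omega
end
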